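/- arXiv:2312.14743 — 7 statements merged into one kernel-verified Lean document; each statement's English description precedes it below -/
import Mathlib

section
/- For integers k ≥ r ≥ 1 and every real x with 0 < x < 1, the (k+1)-st derivative of the function y ↦ y^{k-r}·H(y^r), evaluated at x, equals -r·k! · ∑_{ℓ=0}^{∞} binom(k+rℓ, k) · x^{rℓ-1}/(ℓ+1), where binom denotes the ordinary binomial coefficient and the (k+1)-st derivative is the (k+1)-fold iterated derivative. -/
open Filter Topology

/-- The series of `m`-th derivatives of `y ^ n`, along an injective sequence of exponents and
with bounded coefficients, converges in the open unit interval. -/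
lemma summable_mul_descFactorial_mul_pow {a : ℕ → ℝ} {C : ℝ} (ha : ∀ n, |a n| ≤ C)
    {p : ℕ → ℕ} (hp : Function.Injective p) (m : ℕ) {x : ℝ} (hx : |x| < 1) :
    Summable fun n ↦ a n * ((p n).descFactorial m * x ^ (p n - m)) := by
  have h : Summable fun n : ℕ ↦ (n.descFactorial m : ℝ) * |x| ^ (n - m) := by
    rw [← summable_nat_add_iff m]
    simpa using summable_descFactorial_mul_geometric_of_norm_lt_one (R := ℝ) m (r := |x|)
      (by simpa using hx)
  refine Summable.of_norm_bounded ((h.comp_injective hp).mul_left C) fun n ↦ ?_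
  simp only [Real.norm_eq_abs, abs_mul, abs_pow, Nat.abs_cast, Function.comp_apply]
  gcongr
  exact ha n

lemma hasDerivAt_descFactorial_mul_pow (n m : ℕ) (x : ℝ) :
    HasDerivAt (fun y : ℝ ↦ n.descFactorial m * y ^ (n - m))
      (n.descFactorial (m + 1) * x ^ (n - (m + 1))) x := by
  convert! (hasDerivAt_pow (n - m) x).const_mul (n.descFactorial m : ℝ) using 1
  rw [Nat.descFactorial_succ, Nat.sub_sub]
  push_cast
  ring

/-- Power series with bounded coefficients are differentiated term by term. -/
lemma iteratedDeriv_tsum_mul_pow {a : ℕ → ℝ} {C : ℝ} (ha : ∀ n, |a n| ≤ C)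
    {p : ℕ → ℕ} (hp : Function.Injective p) (m : ℕ) {x : ℝ} (hx : |x| < 1) :
    iteratedDeriv m (fun y ↦ ∑' n, a n * y ^ p n) x
      = ∑' n, a n * ((p n).descFactorial m * x ^ (p n - m)) := by
  induction m generalizing x with
  | zero => simp
  | succ m ih =>
    obtain ⟨R, hxR, hR⟩ := exists_between hx
    have hR0 : 0 < R := (abs_nonneg x).trans_lt hxR
    have hmem : x ∈ Metric.ball (0 : ℝ) R := by simpa using hxR
    have heq : iteratedDeriv m (fun y ↦ ∑' n, a n * y ^ p n) =ᶠ[𝓝 x]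
        fun y ↦ ∑' n, a n * ((p n).descFactorial m * y ^ (p n - m)) := by
      filter_upwards [Metric.isOpen_ball.mem_nhds hmem] with y hy
      exact ih (lt_trans (by simpa using hy) hR)
    rw [iteratedDeriv_succ, heq.deriv_eq]
    have hR' : |R| < 1 := by rwa [abs_of_pos hR0]
    refine (hasDerivAt_tsum_of_isPreconnected
      (u := fun n ↦ C * ((p n).descFactorial (m + 1) * R ^ (p n - (m + 1))))
      (summable_mul_descFactorial_mul_pow (a := fun _ ↦ C) (fun _ ↦ le_rfl) hp (m + 1) hR')
      Metric.isOpen_ball (convex_ball (0 : ℝ) R).isPreconnected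
      (fun n y _ ↦ (hasDerivAt_descFactorial_mul_pow (p n) m y).const_mul (a n))
      (fun n y hy ↦ ?_) hmem (summable_mul_descFactorial_mul_pow ha hp m hx) hmem).deriv
    have hy' : |y| ≤ R := by simpa using (Metric.mem_ball.1 hy).le
    have hC : 0 ≤ C := (abs_nonneg _).trans (ha n)
    simp only [Real.norm_eq_abs, abs_mul, abs_pow, Nat.abs_cast]
    gcongr
    exact ha n

lemma iteratedDeriv_succ_pow_mul_log (k : ℕ) {x : ℝ} (hx : x ≠ 0) :
    iteratedDeriv (k + 1) (fun y ↦ y ^ k * Real.log y) x = k.factorial / x := by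
  induction k with
  | zero => simp [iteratedDeriv_one]
  | succ k ih =>
    have heq : deriv (fun y : ℝ ↦ y ^ (k + 1) * Real.log y) =ᶠ[𝓝 x]
        fun y ↦ ((k + 1 : ℕ) : ℝ) * (y ^ k * Real.log y) + y ^ k := by
      filter_upwards [isOpen_ne.mem_nhds hx] with y hy
      refine ((hasDerivAt_pow (k + 1) y).mul (Real.hasDerivAt_log hy)).deriv.trans ?_
      have : y ≠ 0 := hy
      simp only [Nat.add_sub_cancel]
      field_simp
      ring
    have hlog : ContDiffAt ℝ (k + 1 : ℕ) (fun y ↦ y ^ k * Real.log y) x :=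
      (contDiffAt_id.pow k).mul (Real.contDiffAt_log.2 hx)
    have hpow : ContDiffAt ℝ (k + 1 : ℕ) (fun y : ℝ ↦ y ^ k) x := contDiffAt_id.pow k
    rw [iteratedDeriv_succ', heq.iteratedDeriv_eq,
      iteratedDeriv_fun_add (contDiffAt_const.mul hlog) hpow,
      iteratedDeriv_const_mul _ hlog, ih, iteratedDeriv_pow, Nat.factorial_succ,
      Nat.descFactorial_of_lt k.lt_succ_self]
    push_cast
    ring

/-- The expansion of `-(1 - t) * log (1 - t)`; the term `1 / 0 = 0` at `n = 0` is intended. -/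
lemma hasSum_one_sub_mul_log_one_sub {t : ℝ} (ht : |t| < 1) :
    HasSum (fun n : ℕ ↦ (1 / ((n : ℝ) + 1) - 1 / n) * t ^ (n + 1))
      (-((1 - t) * Real.log (1 - t))) := by
  have h1 := Real.hasSum_pow_div_log_of_abs_lt_one ht
  have h2 : HasSum (fun n : ℕ ↦ t ^ (n + 1) / n) (t * -Real.log (1 - t)) := by
    rw [← hasSum_nat_add_iff' 1]
    simp only [Finset.sum_range_one, Nat.cast_zero, div_zero, sub_zero]
    convert! h1.mul_left t using 2 with n
    push_cast
    ring
  have h3 := h1.sub h2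
  ring_nf at h3 ⊢
  exact h3

/-- For integers `k ≥ r ≥ 1` and real `0 < x < 1`, the `(k+1)`-st derivative of
`y ↦ y^{k-r}·H(y^r)` at `x` equals `-r·k! · ∑_{ℓ=0}^∞ C(k+rℓ, k)·x^{rℓ-1}/(ℓ+1)`. -/
theorem stmt1 (k r : ℕ) (hr : 1 ≤ r) (hrk : r ≤ k) (x : ℝ) (hx0 : 0 < x) (hx1 : x < 1) :
    iteratedDeriv (k + 1) (fun y : ℝ => y ^ (k - r) * Real.binEntropy (y ^ r)) x
      = -(r * Nat.factorial k : ℝ)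
          * ∑' ℓ : ℕ, ((k + r * ℓ).choose k : ℝ) * x ^ ((r * ℓ : ℤ) - 1) / ((ℓ : ℝ) + 1) := by
  set p : ℕ → ℕ := fun ℓ ↦ k + r * ℓ with hp
  set c : ℕ → ℝ := fun ℓ ↦ 1 / ((ℓ : ℝ) + 1) - 1 / ℓ with hc
  have hp_inj : Function.Injective p := fun m n h ↦
    Nat.eq_of_mul_eq_mul_left hr (Nat.add_left_cancel h)
  have hc_le : ∀ ℓ, |c ℓ| ≤ 1 := by
    intro ℓ
    rcases Nat.eq_zero_or_pos ℓ with rfl | hℓ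
    · simp [hc]
    · have h1 : (1 : ℝ) ≤ ℓ := by exact_mod_cast hℓ
      have h2 : 1 / (ℓ : ℝ) ≤ 1 := by rw [div_le_one] <;> linarith
      have h3 : 1 / ((ℓ : ℝ) + 1) ≤ 1 := by rw [div_le_one] <;> linarith
      have h4 : 0 ≤ 1 / (ℓ : ℝ) := by positivity
      have h5 : 0 ≤ 1 / ((ℓ : ℝ) + 1) := by positivity
      rw [abs_le]
      constructor <;> simp only [hc] <;> linarith
  have hx_abs : |x| < 1 := by rwa [abs_of_pos hx0]
  set g : ℝ → ℝ := fun y ↦ y ^ (k - r) * -((1 - y ^ r) * Real.log (1 - y ^ r)) with hg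
  have hsplit : (fun y : ℝ ↦ y ^ (k - r) * Real.binEntropy (y ^ r))
      = fun y ↦ (-r : ℝ) * (y ^ k * Real.log y) + g y := by
    funext y
    have hk : y ^ k = y ^ (k - r) * y ^ r := by rw [← pow_add, Nat.sub_add_cancel hrk]
    simp only [hg, Real.binEntropy, Real.log_inv, Real.log_pow, hk]
    ring
  have hseries : g =ᶠ[𝓝 x] fun y ↦ ∑' ℓ, c ℓ * y ^ p ℓ := by
    filter_upwards [Ioo_mem_nhds hx0 hx1] with y hy
    have hy1 : |y ^ r| < 1 := by
      rw [abs_of_pos (pow_pos hy.1 r)]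
      exact pow_lt_one₀ hy.1.le hy.2 (by omega)
    refine ((hasSum_one_sub_mul_log_one_sub hy1).mul_left (y ^ (k - r))).tsum_eq.symm.trans ?_
    refine tsum_congr fun ℓ ↦ ?_
    have : p ℓ = (k - r) + r * (ℓ + 1) := by simp only [hp, mul_add]; omega
    rw [this, pow_add _ (k - r), pow_mul]
    ring
  have hlog : ContDiffAt ℝ (k + 1 : ℕ) (fun y ↦ y ^ k * Real.log y) x :=
    (contDiffAt_id.pow k).mul (Real.contDiffAt_log.2 hx0.ne')
  have hg_diff : ContDiffAt ℝ (k + 1 : ℕ) g x := by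
    have h0 : 1 - x ^ r ≠ 0 := (sub_pos.2 (pow_lt_one₀ hx0.le hx1 (by omega))).ne'
    have h1 : ContDiffAt ℝ (k + 1 : ℕ) (fun y : ℝ ↦ 1 - y ^ r) x :=
      contDiffAt_const.sub (contDiffAt_id.pow r)
    exact (contDiffAt_id.pow _).mul (h1.mul (h1.log h0)).neg
  rw [hsplit, iteratedDeriv_fun_add (contDiffAt_const.mul hlog) hg_diff,
    iteratedDeriv_const_mul _ hlog, iteratedDeriv_succ_pow_mul_log k hx0.ne',
    hseries.iteratedDeriv_eq, iteratedDeriv_tsum_mul_pow hc_le hp_inj (k + 1) hx_abs,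
    ← tsum_mul_left]
  have hsum := (hasSum_ite_eq 0 (-r * (k.factorial / x) : ℝ)).add
    (summable_mul_descFactorial_mul_pow hc_le hp_inj (k + 1) hx_abs).hasSum
  rw [← hsum.tsum_eq]
  refine tsum_congr fun ℓ ↦ ?_
  rcases Nat.eq_zero_or_pos ℓ with rfl | hℓ
  · simp [hp]
    ring
  · have hrℓ : 1 ≤ r * ℓ := Nat.mul_pos hr hℓ
    have hpow : x ^ ((r * ℓ : ℤ) - 1) = x ^ (p ℓ - (k + 1)) := by
      rw [← zpow_natCast]
      congr 1
      simp only [hp]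
      push_cast [Nat.add_sub_add_left, Nat.cast_sub hrℓ]
      ring
    have hdesc : ((p ℓ).descFactorial (k + 1) : ℝ)
        = (r * ℓ) * (k.factorial * (k + r * ℓ).choose k) := by
      rw [Nat.descFactorial_succ, Nat.descFactorial_eq_factorial_mul_choose]
      simp [hp]
    have hℓ' : (ℓ : ℝ) ≠ 0 := by exact_mod_cast hℓ.ne'
    have hℓ'' : (ℓ : ℝ) + 1 ≠ 0 := by positivity
    rw [if_neg hℓ.ne', hpow, hdesc]
    simp only [hc]
    field_simp
    ring
end

section
/- For every integer k ≥ 1 and every real x with 0 < x < 1, the (k+1)-st derivative of the function y ↦ y^{k-1}·H(y), evaluated at x, equals ((k-1)!/x²)·(1 - 1/(1-x)^k). -/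
/-- Leibniz rule for multiplication by the identity. -/
lemma iteratedDeriv_succ_id_mul {f : ℝ → ℝ} {x : ℝ} (n : ℕ)
    (hf : ContDiffAt ℝ (n + 1 : ℕ) f x) :
    iteratedDeriv (n + 1) (fun y => y * f y) x
      = x * iteratedDeriv (n + 1) f x + (n + 1) * iteratedDeriv n f x := by
  rw [iteratedDeriv_fun_mul contDiffAt_fun_id hf, Finset.sum_range_succ', Finset.sum_range_succ']
  simp [iteratedDeriv_fun_id]
  ring

lemma Real.contDiffAt_binEntropy {n : WithTop ℕ∞} {x : ℝ} (hx0 : x ≠ 0) (hx1 : x ≠ 1) :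
    ContDiffAt ℝ n Real.binEntropy x := by
  have h1 : 1 - x ≠ 0 := sub_ne_zero.mpr hx1.symm
  rw [Real.binEntropy_eq_negMulLog_add_negMulLog_one_sub']
  unfold Real.negMulLog
  fun_prop (disch := assumption)

lemma iteratedDeriv_pow_mul_binEntropy (n : ℕ) {x : ℝ} (hx : x ∈ Set.Ioo (0 : ℝ) 1) :
    iteratedDeriv (n + 2) (fun y : ℝ => y ^ n * Real.binEntropy y) x
      = (Nat.factorial n : ℝ) / x ^ 2 * (1 - 1 / (1 - x) ^ (n + 1)) := by
  induction n generalizing x with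
  | zero =>
    have hx0 : x ≠ 0 := hx.1.ne'
    have hx1 : 1 - x ≠ 0 := (sub_pos.mpr hx.2).ne'
    have h : iteratedDeriv 2 Real.binEntropy x = -1 / (x * (1 - x)) := by
      rw [iteratedDeriv_eq_iterate, Real.deriv2_binEntropy]
    simp only [pow_zero, one_mul, zero_add, h, Nat.factorial_zero, Nat.cast_one, pow_one]
    field_simp
    ring
  | succ n ih =>
    have hx0 : x ≠ 0 := hx.1.ne'
    have hx1 : 1 - x ≠ 0 := (sub_pos.mpr hx.2).ne'
    have hcd : ContDiffAt ℝ (n + 2 + 1 : ℕ) (fun y : ℝ => y ^ n * Real.binEntropy y) x :=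
      (contDiffAt_id.pow n).mul (Real.contDiffAt_binEntropy hx0 hx.2.ne)
    have hfun : (fun y : ℝ => y ^ (n + 1) * Real.binEntropy y)
        = fun y => y * (y ^ n * Real.binEntropy y) := by
      ext y
      ring
    have hev : iteratedDeriv (n + 2) (fun y : ℝ => y ^ n * Real.binEntropy y)
        =ᶠ[nhds x] fun y => (Nat.factorial n : ℝ) / y ^ 2 * (1 - 1 / (1 - y) ^ (n + 1)) := by
      filter_upwards [isOpen_Ioo.mem_nhds hx] with y hy using ih hy
    have hsub : HasDerivAt (fun y : ℝ => (1 - y) ^ (n + 1)) (-((n + 1) * (1 - x) ^ n)) x := by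
      simpa using ((hasDerivAt_id x).const_sub 1).fun_pow (n + 1)
    have hderiv := ((hasDerivAt_const x (Nat.factorial n : ℝ)).div (hasDerivAt_pow 2 x)
      (pow_ne_zero 2 hx0)).mul
        (((hasDerivAt_const x (1 : ℝ)).div hsub (pow_ne_zero _ hx1)).const_sub 1)
    have hd : deriv (fun y : ℝ => (Nat.factorial n : ℝ) / y ^ 2 * (1 - 1 / (1 - y) ^ (n + 1))) x
        = _ := hderiv.deriv
    rw [hfun, show n + 1 + 2 = n + 2 + 1 from rfl, iteratedDeriv_succ_id_mul (n + 2) hcd, ih hx,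
      iteratedDeriv_succ, hev.deriv_eq, hd, Nat.factorial_succ]
    simp only [Pi.div_apply]
    push_cast
    field_simp
    ring


/-- For every integer `k ≥ 1` and real `0 < x < 1`, the `(k+1)`-st derivative of
`y ↦ y^{k-1}·H(y)` at `x` equals `((k-1)!/x²)·(1 - 1/(1-x)^k)`. -/
theorem stmt4 (k : ℕ) (hk : 1 ≤ k) (x : ℝ) (hx0 : 0 < x) (hx1 : x < 1) :
    iteratedDeriv (k + 1) (fun y : ℝ => y ^ (k - 1) * Real.binEntropy y) x
      = (Nat.factorial (k - 1) : ℝ) / x ^ 2 * (1 - 1 / (1 - x) ^ k) := by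
  obtain ⟨n, rfl⟩ := Nat.exists_eq_add_of_le' hk
  simpa using iteratedDeriv_pow_mul_binEntropy n ⟨hx0, hx1⟩
end

section
/- Let α ∈ (0,1) be the unique real number satisfying α²·(1+α) = 1 (equivalently, α = (1+α)^{-1/2}). Then for every real x with 0 ≤ x ≤ 1, α·H(x^{3/2}) ≥ x^{1/2}·H(x), where x^{3/2} and x^{1/2} denote real powers. -/
open Set Real

/-- A function whose value increases across an interval has positive derivative somewhere. -/
lemma exists_hasDerivAt_pos {f f' : ℝ → ℝ} {a b : ℝ} (hab : a < b)
    (hc : ContinuousOn f (Icc a b)) (hd : ∀ x ∈ Ioo a b, HasDerivAt f (f' x) x)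
    (hlt : f a < f b) : ∃ c ∈ Ioo a b, 0 < f' c := by
  obtain ⟨c, hcm, h⟩ := exists_hasDerivAt_eq_slope f f' hab hc hd
  exact ⟨c, hcm, h ▸ div_pos (sub_pos.2 hlt) (sub_pos.2 hab)⟩

/-- A function whose value decreases across an interval has negative derivative somewhere. -/
lemma exists_hasDerivAt_neg {f f' : ℝ → ℝ} {a b : ℝ} (hab : a < b)
    (hc : ContinuousOn f (Icc a b)) (hd : ∀ x ∈ Ioo a b, HasDerivAt f (f' x) x)
    (hlt : f b < f a) : ∃ c ∈ Ioo a b, f' c < 0 := by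
  obtain ⟨c, hcm, h⟩ := exists_hasDerivAt_eq_slope f f' hab hc hd
  exact ⟨c, hcm, h ▸ div_neg_of_neg_of_pos (sub_neg.2 hlt) (sub_pos.2 hab)⟩

/-- The entropy gap after the substitution `x = y ^ 2`. -/
noncomputable def entropyGap (α y : ℝ) : ℝ :=
  α * binEntropy (y ^ 3) - y * binEntropy (y ^ 2)

/-- The derivative of `entropyGap α`, divided by `y ^ 2`. -/
noncomputable def entropyGapSlope (α y : ℝ) : ℝ :=
  (6 - 9 * α) * log y + 3 * α * log (1 - y ^ 3) + (1 / y ^ 2 - 3) * log (1 - y ^ 2)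

/-- The derivative of `entropyGapSlope α`, multiplied by `y ^ 3 / 2`. -/
noncomputable def entropyGapCurvature (α y : ℝ) : ℝ :=
  (3 - 9 / 2 * α) * y ^ 2 - 9 / 2 * α * (y ^ 5 / (1 - y ^ 3)) - log (1 - y ^ 2)
    - (1 - 3 * y ^ 2) * y ^ 2 / (1 - y ^ 2)

/-- The numerator of the derivative of `entropyGapCurvature α`. -/
noncomputable def entropyGapPoly (α y : ℝ) : ℝ :=
  6 + 12 * y + 16 * y ^ 2 + 8 * y ^ 3 - 4 * y ^ 5 - 2 * y ^ 6
    - α * (9 + 18 * y + 9 * y ^ 2 + 9 / 2 * y ^ 3 + 9 * y ^ 4 + 9 / 2 * y ^ 5)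

/-- The derivative of `entropyGapPoly α`. -/
noncomputable def entropyGapPolyDeriv (α y : ℝ) : ℝ :=
  12 + 32 * y + 24 * y ^ 2 - 20 * y ^ 4 - 12 * y ^ 5
    - α * (18 + 18 * y + 27 / 2 * y ^ 2 + 36 * y ^ 3 + 45 / 2 * y ^ 4)

lemma continuous_entropyGap (α : ℝ) : Continuous (entropyGap α) := by
  unfold entropyGap
  fun_prop

lemma hasDerivAt_entropyGap (α : ℝ) {y : ℝ} (h0 : 0 < y) (h1 : y < 1) :
    HasDerivAt (entropyGap α) (y ^ 2 * entropyGapSlope α y) y := by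
  have h2 : y ^ 2 < 1 := pow_lt_one₀ h0.le h1 (by norm_num)
  have h3 : y ^ 3 < 1 := pow_lt_one₀ h0.le h1 (by norm_num)
  have e2 := HasDerivAt.comp (h := fun z : ℝ => z ^ 2) y
    (hasDerivAt_binEntropy (pow_pos h0 2).ne' h2.ne) (hasDerivAt_pow 2 y)
  have e3 := HasDerivAt.comp (h := fun z : ℝ => z ^ 3) y
    (hasDerivAt_binEntropy (pow_pos h0 3).ne' h3.ne) (hasDerivAt_pow 3 y)
  have e := (e3.const_mul α).sub ((hasDerivAt_id y).mul e2)
  refine e.congr_deriv ?_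
  simp only [Function.comp, id, entropyGapSlope, binEntropy_eq_negMulLog_add_negMulLog_one_sub,
    negMulLog, log_pow]
  push_cast
  field_simp
  ring

lemma hasDerivAt_entropyGapSlope (α : ℝ) {y : ℝ} (h0 : 0 < y) (h1 : y < 1) :
    HasDerivAt (entropyGapSlope α) (2 / y ^ 3 * entropyGapCurvature α y) y := by
  have h2 : 1 - y ^ 2 ≠ 0 := (sub_pos.2 (pow_lt_one₀ h0.le h1 (by norm_num))).ne'
  have h3 : 1 - y ^ 3 ≠ 0 := (sub_pos.2 (pow_lt_one₀ h0.le h1 (by norm_num))).ne'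
  have l1 := (hasDerivAt_log h0.ne').const_mul (6 - 9 * α)
  have l2 := ((hasDerivAt_pow 2 y).const_sub 1).log h2
  have l3 := (((hasDerivAt_pow 3 y).const_sub 1).log h3).const_mul (3 * α)
  have r := (((hasDerivAt_pow 2 y).fun_inv (pow_pos h0 2).ne').const_mul 1).sub_const 3
  have e := (l1.add l3).add (r.mul l2)
  refine (e.congr_deriv ?_).congr_of_eventuallyEq (.of_forall fun z => ?_)
  · simp only [entropyGapCurvature]
    push_cast
    field_simp
    ring
  · simp [entropyGapSlope]

lemma hasDerivAt_entropyGapCurvature (α : ℝ) {y : ℝ} (h0 : 0 ≤ y) (h1 : y < 1) :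
    HasDerivAt (entropyGapCurvature α)
      (y / ((1 - y) * (1 + y) * (1 + y + y ^ 2)) ^ 2 * entropyGapPoly α y) y := by
  have h2 : 1 - y ^ 2 ≠ 0 := (sub_pos.2 (pow_lt_one₀ h0 h1 (by norm_num))).ne'
  have h3 : 1 - y ^ 3 ≠ 0 := (sub_pos.2 (pow_lt_one₀ h0 h1 (by norm_num))).ne'
  have ha : 1 - y ≠ 0 := (sub_pos.2 h1).ne'
  have hb : 1 + y ≠ 0 := by positivity
  have hc : 1 + y + y ^ 2 ≠ 0 := by positivity
  have d2 := (hasDerivAt_pow 2 y).const_sub 1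
  have d3 := (hasDerivAt_pow 3 y).const_sub 1
  have e := ((((hasDerivAt_pow 2 y).const_mul (3 - 9 / 2 * α)).sub
    (((hasDerivAt_pow 5 y).div d3 h3).const_mul (9 / 2 * α))).sub (d2.log h2)).sub
    (((((hasDerivAt_pow 2 y).const_mul 3).const_sub 1).mul (hasDerivAt_pow 2 y)).div d2 h2)
  refine e.congr_deriv ?_
  have f2 : 1 - y ^ 2 = (1 - y) * (1 + y) := by ring
  have f3 : 1 - y ^ 3 = (1 - y) * (1 + y + y ^ 2) := by ring
  simp only [entropyGapPoly, f2, f3, Pi.mul_apply]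
  push_cast
  field_simp
  ring

lemma hasDerivAt_entropyGapPoly (α y : ℝ) :
    HasDerivAt (entropyGapPoly α) (entropyGapPolyDeriv α y) y := by
  have p := fun n => hasDerivAt_pow (𝕜 := ℝ) n y
  have e := (((((((p 1).const_mul 12).const_add 6).add ((p 2).const_mul 16)).add
    ((p 3).const_mul 8)).sub ((p 5).const_mul 4)).sub ((p 6).const_mul 2)).sub
    (((((((p 1).const_mul 18).const_add 9).add ((p 2).const_mul 9)).add
    ((p 3).const_mul (9 / 2))).add ((p 4).const_mul 9)).add
    ((p 5).const_mul (9 / 2)) |>.const_mul α)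
  refine (e.congr_deriv ?_).congr_of_eventuallyEq (.of_forall fun z => ?_)
  · simp only [entropyGapPolyDeriv]
    push_cast
    ring
  · simp [entropyGapPoly]

section

variable {α y : ℝ}

lemma entropyGapPoly_neg (hα : 0.754 < α) (h0 : 0 ≤ y) (h1 : y ≤ 0.35) :
    entropyGapPoly α y < 0 := by
  have hm : 0.754 * (9 + 18 * y + 9 * y ^ 2 + 9 / 2 * y ^ 3 + 9 * y ^ 4 + 9 / 2 * y ^ 5)
      ≤ α * (9 + 18 * y + 9 * y ^ 2 + 9 / 2 * y ^ 3 + 9 * y ^ 4 + 9 / 2 * y ^ 5) := by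
    gcongr
  have b := fun i j => mul_nonneg (pow_nonneg h0 i) (pow_nonneg (sub_nonneg.2 h1) j)
  unfold entropyGapPoly
  linarith [b 0 6, b 1 5, b 2 4, b 3 3, b 4 2, b 5 1, b 6 0]

lemma entropyGapPoly_pos (hα : α < 0.755) (h0 : 0.6 ≤ y) (h1 : y ≤ 0.755) :
    0 < entropyGapPoly α y := by
  have hy : 0 ≤ y := by linarith
  have hm : α * (9 + 18 * y + 9 * y ^ 2 + 9 / 2 * y ^ 3 + 9 * y ^ 4 + 9 / 2 * y ^ 5)
      ≤ 0.755 * (9 + 18 * y + 9 * y ^ 2 + 9 / 2 * y ^ 3 + 9 * y ^ 4 + 9 / 2 * y ^ 5) := by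
    gcongr
  have b := fun i j => mul_nonneg (pow_nonneg (sub_nonneg.2 h0) i)
    (pow_nonneg (sub_nonneg.2 h1) j)
  unfold entropyGapPoly
  linarith [b 0 6, b 1 5, b 2 4, b 3 3, b 4 2, b 5 1, b 6 0]

lemma entropyGapPolyDeriv_pos (hα : α < 0.755) (h0 : 0.35 ≤ y) (h1 : y ≤ 0.6) :
    0 < entropyGapPolyDeriv α y := by
  have hy : 0 ≤ y := by linarith
  have hm : α * (18 + 18 * y + 27 / 2 * y ^ 2 + 36 * y ^ 3 + 45 / 2 * y ^ 4)
      ≤ 0.755 * (18 + 18 * y + 27 / 2 * y ^ 2 + 36 * y ^ 3 + 45 / 2 * y ^ 4) := by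
    gcongr
  have b := fun i j => mul_nonneg (pow_nonneg (sub_nonneg.2 h0) i)
    (pow_nonneg (sub_nonneg.2 h1) j)
  unfold entropyGapPolyDeriv
  linarith [b 0 5, b 1 4, b 2 3, b 3 2, b 4 1, b 5 0]

lemma entropyGapPolyDeriv_neg (hα : 0.754 < α) (h0 : 0.75 ≤ y) (h1 : y ≤ 1) :
    entropyGapPolyDeriv α y < 0 := by
  have hy : 0 ≤ y := by linarith
  have hm : 0.754 * (18 + 18 * y + 27 / 2 * y ^ 2 + 36 * y ^ 3 + 45 / 2 * y ^ 4)
      ≤ α * (18 + 18 * y + 27 / 2 * y ^ 2 + 36 * y ^ 3 + 45 / 2 * y ^ 4) := by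
    gcongr
  have b := fun i j => mul_nonneg (pow_nonneg (sub_nonneg.2 h0) i)
    (pow_nonneg (sub_nonneg.2 h1) j)
  unfold entropyGapPolyDeriv
  linarith [b 0 5, b 1 4, b 2 3, b 3 2, b 4 1, b 5 0]

lemma continuousOn_of_hasDerivAt {f f' : ℝ → ℝ} {s : Set ℝ}
    (h : ∀ x ∈ s, HasDerivAt f (f' x) x) : ContinuousOn f s :=
  fun x hx => (h x hx).continuousAt.continuousWithinAt

/-- On `[0, 0.755]` the polynomial changes sign at most once, from negative to positive. -/
lemma entropyGapPoly_nonneg_of_pos (hα : 0.754 < α) (hα' : α < 0.755) {r s : ℝ} (hr : 0 ≤ r)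
    (hrs : r < s) (hs : s ≤ 0.755) (h : 0 < entropyGapPoly α r) : 0 ≤ entropyGapPoly α s := by
  by_contra! hneg
  have hr' : 0.35 < r := by
    by_contra! hc
    exact (entropyGapPoly_neg hα hr hc).not_gt h
  have hs' : s < 0.6 := by
    by_contra! hc
    exact (entropyGapPoly_pos hα' hc hs).not_gt hneg
  obtain ⟨c, hc, hc'⟩ := exists_hasDerivAt_neg hrs
    (continuousOn_of_hasDerivAt fun x _ => hasDerivAt_entropyGapPoly α x)
    (fun x _ => hasDerivAt_entropyGapPoly α x) (hneg.trans h)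
  exact (entropyGapPolyDeriv_pos hα' (hr'.trans hc.1).le (hc.2.trans hs').le).not_gt hc'

/-- On `[0.75, 1]` the polynomial changes sign at most once, from positive to negative. -/
lemma entropyGapPoly_nonpos_of_neg (hα : 0.754 < α) {r s : ℝ} (hr : 0.75 ≤ r)
    (hrs : r < s) (hs : s ≤ 1) (h : entropyGapPoly α r < 0) : entropyGapPoly α s ≤ 0 := by
  by_contra! hpos
  obtain ⟨c, hc, hc'⟩ := exists_hasDerivAt_pos hrs
    (continuousOn_of_hasDerivAt fun x _ => hasDerivAt_entropyGapPoly α x)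
    (fun x _ => hasDerivAt_entropyGapPoly α x) (h.trans hpos)
  exact (entropyGapPolyDeriv_neg hα (hr.trans hc.1.le) (hc.2.le.trans hs)).not_gt hc'

lemma curvature_factor_nonneg (h0 : 0 ≤ y) :
    0 ≤ y / ((1 - y) * (1 + y) * (1 + y + y ^ 2)) ^ 2 := by
  positivity

lemma entropyGapPoly_pos_of_curvature_lt {p q : ℝ} (hp : 0 ≤ p) (hpq : p < q) (hq : q < 1)
    (h : entropyGapCurvature α p < entropyGapCurvature α q) :
    ∃ c ∈ Ioo p q, 0 < entropyGapPoly α c := by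
  obtain ⟨c, hc, hc'⟩ := exists_hasDerivAt_pos hpq
    (continuousOn_of_hasDerivAt fun x hx =>
      hasDerivAt_entropyGapCurvature α (hp.trans hx.1) (hx.2.trans_lt hq))
    (fun x hx => hasDerivAt_entropyGapCurvature α (hp.trans hx.1.le) (hx.2.trans hq)) h
  exact ⟨c, hc, pos_of_mul_pos_right hc' (curvature_factor_nonneg (hp.trans hc.1.le))⟩

lemma entropyGapPoly_neg_of_curvature_lt {p q : ℝ} (hp : 0 ≤ p) (hpq : p < q) (hq : q < 1)
    (h : entropyGapCurvature α q < entropyGapCurvature α p) :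
    ∃ c ∈ Ioo p q, entropyGapPoly α c < 0 := by
  obtain ⟨c, hc, hc'⟩ := exists_hasDerivAt_neg hpq
    (continuousOn_of_hasDerivAt fun x hx =>
      hasDerivAt_entropyGapCurvature α (hp.trans hx.1) (hx.2.trans_lt hq))
    (fun x hx => hasDerivAt_entropyGapCurvature α (hp.trans hx.1.le) (hx.2.trans hq)) h
  exact ⟨c, hc, neg_of_mul_neg_right hc' (curvature_factor_nonneg (hp.trans hc.1.le))⟩

lemma curvature_pos_of_slope_lt {p q : ℝ} (hp : 0 < p) (hpq : p < q) (hq : q < 1)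
    (h : entropyGapSlope α p < entropyGapSlope α q) :
    ∃ c ∈ Ioo p q, 0 < entropyGapCurvature α c := by
  obtain ⟨c, hc, hc'⟩ := exists_hasDerivAt_pos hpq
    (continuousOn_of_hasDerivAt fun x hx =>
      hasDerivAt_entropyGapSlope α (hp.trans_le hx.1) (hx.2.trans_lt hq))
    (fun x hx => hasDerivAt_entropyGapSlope α (hp.trans hx.1) (hx.2.trans hq)) h
  have := hp.trans hc.1
  exact ⟨c, hc, pos_of_mul_pos_right hc' (by positivity)⟩

lemma curvature_neg_of_slope_lt {p q : ℝ} (hp : 0 < p) (hpq : p < q) (hq : q < 1)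
    (h : entropyGapSlope α q < entropyGapSlope α p) :
    ∃ c ∈ Ioo p q, entropyGapCurvature α c < 0 := by
  obtain ⟨c, hc, hc'⟩ := exists_hasDerivAt_neg hpq
    (continuousOn_of_hasDerivAt fun x hx =>
      hasDerivAt_entropyGapSlope α (hp.trans_le hx.1) (hx.2.trans_lt hq))
    (fun x hx => hasDerivAt_entropyGapSlope α (hp.trans hx.1) (hx.2.trans hq)) h
  have := hp.trans hc.1
  exact ⟨c, hc, neg_of_mul_neg_right hc' (by positivity)⟩

lemma slope_pos_of_entropyGap_lt {p q : ℝ} (hp : 0 ≤ p) (hpq : p < q) (hq : q ≤ 1)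
    (h : entropyGap α p < entropyGap α q) : ∃ c ∈ Ioo p q, 0 < entropyGapSlope α c := by
  obtain ⟨c, hc, hc'⟩ := exists_hasDerivAt_pos hpq (continuous_entropyGap α).continuousOn
    (fun x hx => hasDerivAt_entropyGap α (hp.trans_lt hx.1) (hx.2.trans_le hq)) h
  exact ⟨c, hc, pos_of_mul_pos_right hc' (sq_nonneg c)⟩

lemma slope_neg_of_entropyGap_lt {p q : ℝ} (hp : 0 ≤ p) (hpq : p < q) (hq : q ≤ 1)
    (h : entropyGap α q < entropyGap α p) : ∃ c ∈ Ioo p q, entropyGapSlope α c < 0 := by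
  obtain ⟨c, hc, hc'⟩ := exists_hasDerivAt_neg hpq (continuous_entropyGap α).continuousOn
    (fun x hx => hasDerivAt_entropyGap α (hp.trans_lt hx.1) (hx.2.trans_le hq)) h
  exact ⟨c, hc, neg_of_mul_neg_right hc' (sq_nonneg c)⟩

lemma lower_bound_of_sq_mul_one_add_eq_one (hα0 : 0 < α) (hfe : α ^ 2 * (1 + α) = 1) :
    0.754 < α := by
  by_contra! h
  have : α ^ 2 * (1 + α) ≤ 0.754 ^ 2 * (1 + 0.754) := by gcongr
  norm_num at this
  linarith

lemma upper_bound_of_sq_mul_one_add_eq_one (hfe : α ^ 2 * (1 + α) = 1) : α < 0.755 := by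
  by_contra! h
  have : 0.755 ^ 2 * (1 + 0.755) ≤ α ^ 2 * (1 + α) := by gcongr
  norm_num at this
  linarith

lemma entropyGap_self (hfe : α ^ 2 * (1 + α) = 1) : entropyGap α α = 0 := by
  have h : α ^ 3 = 1 - α ^ 2 := by linarith
  simp [entropyGap, h]

lemma entropyGapSlope_self (hα0 : 0 < α) (hfe : α ^ 2 * (1 + α) = 1) :
    entropyGapSlope α α = 0 := by
  have h2 : 1 - α ^ 2 = α ^ 3 := by linarith
  have h3 : 1 - α ^ 3 = α ^ 2 := by linarith
  have hi : 1 / α ^ 2 = 1 + α := by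
    field_simp
    linarith
  rw [entropyGapSlope, h2, h3, hi, log_pow, log_pow]
  push_cast
  ring

lemma entropyGapCurvature_self_pos (hα0 : 0 < α) (hfe : α ^ 2 * (1 + α) = 1) :
    0 < entropyGapCurvature α α := by
  have l := lower_bound_of_sq_mul_one_add_eq_one hα0 hfe
  have u := upper_bound_of_sq_mul_one_add_eq_one hfe
  have h2 : 1 - α ^ 2 = α ^ 3 := by linarith
  have h3 : 1 - α ^ 3 = α ^ 2 := by linarith
  have hlog : log α ≤ -0.27 := by
    calc log α ≤ log (0.9322 ^ 4) := log_le_log hα0 (by norm_num; linarith)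
      _ = 4 * log 0.9322 := by rw [log_pow]; norm_num
      _ ≤ 4 * (0.9322 - 1) := by gcongr; exact log_le_sub_one_of_pos (by norm_num)
      _ ≤ -0.27 := by norm_num
  have e1 : α ^ 5 / α ^ 2 = α ^ 3 := by field_simp
  have e2 : (1 - 3 * α ^ 2) * α ^ 2 / α ^ 3 = α * (1 + α) - 3 * α := by
    field_simp
    linear_combination -hfe
  rw [entropyGapCurvature, h2, h3, log_pow, e1, e2]
  push_cast
  have h4 : α ^ 4 = α - α ^ 3 := by linear_combination α * hfe
  nlinarith

lemma entropyGap_nonneg (hα0 : 0 < α) (hα1 : α < 1) (hfe : α ^ 2 * (1 + α) = 1)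
    (h0 : 0 ≤ y) (h1 : y ≤ 1) : 0 ≤ entropyGap α y := by
  have l := lower_bound_of_sq_mul_one_add_eq_one hα0 hfe
  have u := upper_bound_of_sq_mul_one_add_eq_one hfe
  have gα := entropyGap_self hfe
  have sα := entropyGapSlope_self hα0 hfe
  have cα := entropyGapCurvature_self_pos hα0 hfe
  have g0 : entropyGap α 0 = 0 := by simp [entropyGap]
  have g1 : entropyGap α 1 = 0 := by simp [entropyGap]
  have c0 : entropyGapCurvature α 0 = 0 := by simp [entropyGapCurvature]
  by_contra! hneg
  have hy0 : 0 < y := h0.lt_of_ne (by rintro rfl; exact hneg.ne g0)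
  have hy1 : y < 1 := h1.lt_of_ne (by rintro rfl; exact hneg.ne g1)
  rcases lt_trichotomy y α with hy | rfl | hy
  · obtain ⟨a, ha, ha'⟩ := slope_neg_of_entropyGap_lt le_rfl hy0 h1 (hneg.trans_eq g0.symm)
    obtain ⟨b, hb, hb'⟩ := slope_pos_of_entropyGap_lt h0 hy hα1.le (hneg.trans_eq gα.symm)
    obtain ⟨p, hp, hp'⟩ := curvature_pos_of_slope_lt ha.1 (ha.2.trans hb.1) (hb.2.trans hα1)
      (ha'.trans hb')
    obtain ⟨q, hq, hq'⟩ := curvature_neg_of_slope_lt (hy0.trans hb.1) hb.2 hα1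
      (sα.trans_lt hb')
    have hp0 := ha.1.trans hp.1
    have hpq := hp.2.trans hq.1
    obtain ⟨r, hr, hr'⟩ := entropyGapPoly_pos_of_curvature_lt le_rfl hp0
      (hpq.trans (hq.2.trans hα1)) (c0.trans_lt hp')
    obtain ⟨s, hs, hs'⟩ := entropyGapPoly_neg_of_curvature_lt hp0.le hpq
      (hq.2.trans hα1) (hq'.trans hp')
    exact (entropyGapPoly_nonneg_of_pos l u hr.1.le (hr.2.trans hs.1)
      (hs.2.trans (hq.2.trans u)).le hr').not_gt hs'
  · exact hneg.ne gα
  · obtain ⟨a, ha, ha'⟩ := slope_neg_of_entropyGap_lt hα0.le hy h1 (hneg.trans_eq gα.symm)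
    obtain ⟨b, hb, hb'⟩ := slope_pos_of_entropyGap_lt h0 hy1 le_rfl (hneg.trans_eq g1.symm)
    obtain ⟨p, hp, hp'⟩ := curvature_neg_of_slope_lt hα0 ha.1 (ha.2.trans hy1)
      (ha'.trans_eq sα.symm)
    obtain ⟨q, hq, hq'⟩ := curvature_pos_of_slope_lt (hα0.trans ha.1) (ha.2.trans hb.1) hb.2
      (ha'.trans hb')
    have hpq := hp.2.trans hq.1
    have hq1 := hq.2.trans hb.2
    obtain ⟨r, hr, hr'⟩ := entropyGapPoly_neg_of_curvature_lt hα0.le hp.1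
      (hpq.trans hq1) (hp'.trans cα)
    obtain ⟨s, hs, hs'⟩ := entropyGapPoly_pos_of_curvature_lt (hα0.trans hp.1).le hpq hq1
      (hp'.trans hq')
    have hr0 : 0.75 ≤ r := by linarith [hr.1]
    exact (entropyGapPoly_nonpos_of_neg l hr0 (hr.2.trans hs.1) (hs.2.trans hq1).le hr').not_gt
      hs'

end

/-- Let `α ∈ (0,1)` satisfy `α²·(1+α) = 1`. Then for every real `0 ≤ x ≤ 1`,
`α·H(x^{3/2}) ≥ x^{1/2}·H(x)` (real powers). -/
theorem stmt15 (α : ℝ) (hα0 : 0 < α) (hα1 : α < 1) (hfe : α ^ 2 * (1 + α) = 1) :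
    ∀ x : ℝ, 0 ≤ x → x ≤ 1 →
      α * Real.binEntropy (x ^ ((3 : ℝ) / 2))
        ≥ x ^ ((1 : ℝ) / 2) * Real.binEntropy x := by
  intro x hx0 hx1
  have h := entropyGap_nonneg hα0 hα1 hfe (rpow_nonneg hx0 (1 / 2))
    (rpow_le_one hx0 hx1 (by norm_num))
  have h2 : (x ^ ((1 : ℝ) / 2)) ^ 2 = x := by
    rw [← rpow_mul_natCast hx0]
    norm_num
  have h3 : (x ^ ((1 : ℝ) / 2)) ^ 3 = x ^ ((3 : ℝ) / 2) := by
    rw [← rpow_mul_natCast hx0]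
    norm_num
  rw [entropyGap, h2, h3] at h
  exact sub_nonneg.1 h
end

section
/- For every real k > 1 there exists a unique real α_k ∈ (0,1) with α_k·(1+α_k)^{k-1} = 1 (real power); this α_k satisfies 1/k < α_k < 1; and α_k is strictly decreasing in k, i.e., if 1 < k₁ < k₂ and α_{k₁}, α_{k₂} ∈ (0,1) satisfy the respective equations, then α_{k₂} < α_{k₁}. -/
theorem log_add_mul_log_one_add_eq_zero {k α : ℝ} (hα : 0 < α)
    (h : α * (1 + α) ^ (k - 1) = 1) : Real.log α + (k - 1) * Real.log (1 + α) = 0 := by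
  have h1 : 0 < 1 + α := by linarith
  rw [← Real.log_rpow h1, ← Real.log_mul hα.ne' (Real.rpow_pos_of_pos h1 _).ne', h, Real.log_one]

theorem mul_one_add_rpow_strictMonoOn {k : ℝ} (hk : 1 < k) :
    StrictMonoOn (fun α : ℝ => α * (1 + α) ^ (k - 1)) (Set.Ioi 0) := by
  intro a ha b hb hab
  have ha' : 0 < a := ha
  have h1 : (1 + a) ^ (k - 1) < (1 + b) ^ (k - 1) :=
    Real.rpow_lt_rpow (by linarith) (by linarith) (by linarith)
  have h2 : 0 < (1 + a) ^ (k - 1) := Real.rpow_pos_of_pos (by linarith) _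
  exact mul_lt_mul'' hab h1 ha'.le h2.le

theorem exists_mul_one_add_rpow_eq_one {k : ℝ} (hk : 1 < k) :
    ∃ α ∈ Set.Ioo (0 : ℝ) 1, α * (1 + α) ^ (k - 1) = 1 := by
  have hc : ContinuousOn (fun α : ℝ => α * (1 + α) ^ (k - 1)) (Set.Icc 0 1) :=
    continuousOn_id.mul ((continuousOn_const.add continuousOn_id).rpow_const
      fun x _ => Or.inr (by linarith))
  have h2 : (1 : ℝ) < (1 + 1) ^ (k - 1) := Real.one_lt_rpow (by norm_num) (by linarith)
  exact intermediate_value_Ioo zero_le_one hc ⟨by simp, by simpa using h2⟩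

/-- For every real `k > 1` there is a unique `α ∈ (0,1)` with
`α·(1+α)^{k-1} = 1` (real power); any such `α` satisfies `1/k < α < 1`; and it is strictly
decreasing in `k`. -/
theorem stmt16 :
    (∀ k : ℝ, 1 < k →
        ∃! α : ℝ, α ∈ Set.Ioo (0 : ℝ) 1 ∧ α * (1 + α) ^ (k - 1) = 1)
      ∧ (∀ k α : ℝ, 1 < k → α ∈ Set.Ioo (0 : ℝ) 1 → α * (1 + α) ^ (k - 1) = 1 →
          1 / k < α ∧ α < 1)
      ∧ (∀ k₁ k₂ α₁ α₂ : ℝ, 1 < k₁ → k₁ < k₂ →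
          α₁ ∈ Set.Ioo (0 : ℝ) 1 → α₂ ∈ Set.Ioo (0 : ℝ) 1 →
          α₁ * (1 + α₁) ^ (k₁ - 1) = 1 → α₂ * (1 + α₂) ^ (k₂ - 1) = 1 →
          α₂ < α₁) := by
  refine ⟨fun k hk => ?_, fun k α hk hα h => ⟨?_, hα.2⟩, ?_⟩
  · obtain ⟨α, hα, h⟩ := exists_mul_one_add_rpow_eq_one hk
    refine ⟨α, ⟨hα, h⟩, fun β hβ => ?_⟩
    exact (mul_one_add_rpow_strictMonoOn hk).injOn hβ.1.1 hα.1 (hβ.2.trans h.symm)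
  · have h0 := log_add_mul_log_one_add_eq_zero hα.1 h
    have h1 : Real.log α < α - 1 := Real.log_lt_sub_one_of_pos hα.1 hα.2.ne
    have h2 : Real.log (1 + α) ≤ α := by
      linarith [Real.log_le_sub_one_of_pos (show 0 < 1 + α by linarith [hα.1])]
    have h3 : (k - 1) * Real.log (1 + α) ≤ (k - 1) * α :=
      mul_le_mul_of_nonneg_left h2 (by linarith)
    rw [div_lt_iff₀ (by linarith)]
    linarith
  · intro k₁ k₂ α₁ α₂ hk₁ hk hα₁ hα₂ h₁ h₂
    by_contra! hle
    have e₁ : α₁ * (1 + α₁) ^ (k₁ - 1) ≤ α₂ * (1 + α₂) ^ (k₁ - 1) :=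
      (mul_one_add_rpow_strictMonoOn hk₁).monotoneOn hα₁.1 hα₂.1 hle
    have e₂ : α₂ * (1 + α₂) ^ (k₁ - 1) < α₂ * (1 + α₂) ^ (k₂ - 1) :=
      mul_lt_mul_of_pos_left
        (Real.rpow_lt_rpow_of_exponent_lt (by linarith [hα₂.1]) (by linarith)) hα₂.1
    linarith
end

section
/- Let a : ℝ → ℝ be any function such that for every real k > 1, a(k) ∈ (0,1) and a(k)·(1+a(k))^{k-1} = 1 (real power). Then, as k → ∞, a(k) - (log k)/k = O((log log k)/k); that is, the function k ↦ a(k) - (log k)/k is big-O of k ↦ log(log k)/k along the filter atTop on ℝ. -/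
open Real Filter

/-- A positive solution of `x * (1 + x) ^ (k - 1) = 1` is at least `(log k - log (log k)) / k`. -/
lemma log_sub_log_log_div_le {k x : ℝ} (hk : 1 < k) (hx : 0 < x)
    (h : Real.log x + (k - 1) * Real.log (1 + x) = 0) (hM : 0 ≤ Real.log (Real.log k)) :
    (Real.log k - Real.log (Real.log k)) / k ≤ x := by
  have hL : 0 < Real.log k := Real.log_pos hk
  by_contra! hlt
  have hxk : x * k < Real.log k - Real.log (Real.log k) := (lt_div_iff₀ (by linarith)).1 hlt
  have h1 : Real.log (x * k) ≤ Real.log (Real.log k) :=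
    Real.log_le_log (by positivity) (by linarith)
  rw [Real.log_mul hx.ne' (by linarith)] at h1
  have h2 : (k - 1) * Real.log (1 + x) ≤ (k - 1) * x :=
    mul_le_mul_of_nonneg_left
      (by linarith [Real.log_le_sub_one_of_pos (show 0 < 1 + x by linarith)]) (by linarith)
  nlinarith

/-- A positive solution of `x * (1 + x) ^ (k - 1) = 1` is at most `log k / k` for large `k`. -/
lemma le_log_div {k x : ℝ} (hk : 1 < k) (hx : 0 < x)
    (h : Real.log x + (k - 1) * Real.log (1 + x) = 0) (hM : 1 ≤ Real.log (Real.log k))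
    (hLk : Real.log k * (1 + Real.log k) ≤ k) : x ≤ Real.log k / k := by
  have hL : 0 < Real.log k := Real.log_pos hk
  have hk0 : 0 < k := by linarith
  by_contra! hlt
  have hxk : Real.log k < x * k := (div_lt_iff₀ hk0).1 hlt
  have h1 : Real.log (Real.log k) < Real.log (x * k) := Real.log_lt_log hL hxk
  rw [Real.log_mul hx.ne' hk0.ne'] at h1
  have h2 : Real.log k / (k + Real.log k) ≤ Real.log (1 + x) := calc
    Real.log k / (k + Real.log k) = 1 - (1 + Real.log k / k)⁻¹ := by field_simp; ring
    _ ≤ Real.log (1 + Real.log k / k) := Real.one_sub_inv_le_log_of_pos (by positivity)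
    _ ≤ Real.log (1 + x) := Real.log_le_log (by positivity) (by linarith)
  have h3 : Real.log k - 1 ≤ (k - 1) * (Real.log k / (k + Real.log k)) := by
    rw [← mul_div_assoc, le_div_iff₀ (by positivity)]
    nlinarith
  have h4 : (k - 1) * (Real.log k / (k + Real.log k)) ≤ (k - 1) * Real.log (1 + x) :=
    mul_le_mul_of_nonneg_left h2 (by linarith)
  linarith

/-- If `a : ℝ → ℝ` satisfies, for every `k > 1`, `a(k) ∈ (0,1)` and
`a(k)·(1+a(k))^{k-1} = 1` (real power), then `a(k) - (log k)/k = O((log log k)/k)` as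
`k → ∞`. -/
theorem stmt17 (a : ℝ → ℝ)
    (ha : ∀ k : ℝ, 1 < k → a k ∈ Set.Ioo (0 : ℝ) 1 ∧ a k * (1 + a k) ^ (k - 1) = 1) :
    Asymptotics.IsBigO atTop (fun k : ℝ => a k - Real.log k / k)
      (fun k : ℝ => Real.log (Real.log k) / k) := by
  apply Asymptotics.IsBigO.of_bound 1
  have hlog := (isLittleO_pow_log_id_atTop (n := 2)).def (show (0 : ℝ) < 1 / 2 by norm_num)
  filter_upwards [eventually_gt_atTop 1, hlog, tendsto_log_atTop.eventually_ge_atTop 1,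
    (tendsto_log_atTop.comp tendsto_log_atTop).eventually_ge_atTop 1] with k hk hsq hL hM
  simp only [Function.comp_apply] at hM
  obtain ⟨⟨hx, -⟩, heq⟩ := ha k hk
  have hk0 : 0 < k := by linarith
  have h : Real.log (a k) + (k - 1) * Real.log (1 + a k) = 0 := by
    have := congrArg Real.log heq
    rwa [Real.log_mul hx.ne' (by positivity), Real.log_rpow (by linarith), Real.log_one] at this
  have hLk : Real.log k * (1 + Real.log k) ≤ k := by
    rw [Real.norm_of_nonneg (by positivity), id, Real.norm_of_nonneg hk0.le] at hsq
    nlinarith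
  have hlow := log_sub_log_log_div_le hk hx h (by linarith)
  have hup := le_log_div hk hx h hM hLk
  rw [sub_div] at hlow
  rw [one_mul, Real.norm_eq_abs, Real.norm_of_nonneg (by positivity), abs_le]
  constructor <;> linarith [show 0 ≤ Real.log (Real.log k) / k by positivity]
end

section
/- For every sufficiently large real k there is a unique real b_k ∈ (0, log k) satisfying b_k - log(1 - b_k/log k) = log log k. Moreover, if a : ℝ → ℝ satisfies a(k) ∈ (0,1) and a(k)·(1+a(k))^{k-1} = 1 for all k > 1, and b : ℝ → ℝ satisfies b(k) ∈ (0, log k) and b(k) - log(1 - b(k)/log k) = log log k for all sufficiently large k, then a(k) - (log k - b(k))/k = O((log k)²/k²) as k → ∞ (big-O along the filter atTop on ℝ). -/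
open Real Filter

theorem sub_log_one_sub_div_eq_iff {L b : ℝ} (hL : 0 < L) (hb : b < L) :
    b - log (1 - b / L) = log L ↔ (L - b) + log (L - b) = L := by
  have h : 1 - b / L = (L - b) / L := by field_simp
  rw [h, log_div (by linarith) hL.ne']
  constructor <;> intro h <;> linarith

theorem strictMonoOn_add_log : StrictMonoOn (fun u : ℝ => u + log u) (Set.Ioi 0) :=
  fun _ hx _ _ hxy => add_lt_add hxy (log_lt_log hx hxy)

theorem exists_add_log_eq {L : ℝ} (hL : 1 < L) :
    ∃ u ∈ Set.Ioo 0 L, u + log u = L := by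
  have hc : ContinuousOn (fun u : ℝ => u + log u) (Set.Icc 1 L) :=
    continuousOn_id.add (continuousOn_log.mono fun x hx => by
      simpa using (zero_lt_one.trans_le hx.1).ne')
  have hlog := log_pos hL
  obtain ⟨u, hu, hu'⟩ := intermediate_value_Ioo hL.le hc
    (show L ∈ Set.Ioo _ _ by constructor <;> simp <;> linarith)
  exact ⟨u, ⟨by linarith [hu.1], hu.2⟩, hu'⟩

theorem existsUnique_sub_log_one_sub_div_eq {L : ℝ} (hL : 1 < L) :
    ∃! b : ℝ, b ∈ Set.Ioo (0 : ℝ) L ∧ b - log (1 - b / L) = log L := by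
  have hL0 : 0 < L := by linarith
  obtain ⟨u, hu, he⟩ := exists_add_log_eq hL
  refine ⟨L - u, ⟨⟨sub_pos.2 hu.2, by linarith [hu.1]⟩, ?_⟩, ?_⟩
  · rw [sub_log_one_sub_div_eq_iff hL0 (by linarith [hu.1])]
    simpa using he
  · rintro c ⟨hc, hce⟩
    rw [sub_log_one_sub_div_eq_iff hL0 hc.2] at hce
    have := strictMonoOn_add_log.injOn (show L - c ∈ Set.Ioi 0 from sub_pos.2 hc.2) hu.1
      (hce.trans he.symm)
    linarith

theorem sub_sq_div_two_le_log_one_add {x : ℝ} (hx : 0 ≤ x) : x - x ^ 2 / 2 ≤ log (1 + x) := by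
  refine le_trans ?_ (le_log_one_add_of_nonneg hx)
  rw [le_div_iff₀ (by linarith)]
  nlinarith [pow_nonneg hx 3]

/-- A solution of `x * (1 + x) ^ (k - 1) = 1` is of size `O(log k / k)`. -/
theorem le_of_log_add_mul_log_eq_zero {k x : ℝ} (hk : 2 ≤ k) (hlog : 1 ≤ log k)
    (hx : x ∈ Set.Ioo (0 : ℝ) 1) (h : log x + (k - 1) * log (1 + x) = 0) :
    k * x ≤ 4 * log k := by
  by_contra! hlt
  have hkx : 0 ≤ log (k * x) := log_nonneg (by linarith)
  rw [log_mul (by linarith) hx.1.ne'] at hkx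
  have h1 : x / 2 ≤ log (1 + x) := by
    nlinarith [sub_sq_div_two_le_log_one_add hx.1.le, hx.1, hx.2]
  have h2 := mul_le_mul_of_nonneg_left h1 (show 0 ≤ k - 1 by linarith)
  nlinarith [hx.1]

theorem abs_sub_div_le {k x u : ℝ} (hk : 2 ≤ k) (hlog : 1 ≤ log k)
    (hx : x ∈ Set.Ioo (0 : ℝ) 1) (h : log x + (k - 1) * log (1 + x) = 0)
    (hu : 0 < u) (hu' : u + log u = log k) :
    |x - u / k| ≤ 12 * (log k ^ 2 / k ^ 2) := by
  have hk0 : 0 < k := by linarith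
  have hx0 := hx.1
  have hsize := le_of_log_add_mul_log_eq_zero hk hlog hx h
  have hkx : 0 < k * x := mul_pos hk0 hx0
  have hlogkx : log (k * x) = log k + log x := log_mul hk0.ne' hx0.ne'
  have hupper : log (1 + x) ≤ x := by linarith [log_le_sub_one_of_pos (show 0 < 1 + x by linarith)]
  have hlower := sub_sq_div_two_le_log_one_add hx0.le
  have hle : u ≤ k * x := by
    refine (strictMonoOn_add_log.le_iff_le hu hkx).1 ?_
    nlinarith
  have hloglog : log u ≤ log (k * x) := log_le_log hu hle
  have hdiff : k * x - u ≤ x + k * x ^ 2 / 2 := by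
    nlinarith [mul_le_mul_of_nonneg_left hlower (show 0 ≤ k - 1 by linarith), sq_nonneg x]
  have hsq : (k * x) ^ 2 ≤ (4 * log k) ^ 2 := pow_le_pow_left₀ hkx.le hsize 2
  have heq : x - u / k = k * (k * x - u) / k ^ 2 := by field_simp
  rw [heq, abs_of_nonneg (div_nonneg (mul_nonneg hk0.le (by linarith)) (by positivity)),
    ← mul_div_assoc]
  refine div_le_div_of_nonneg_right ?_ (by positivity)
  nlinarith [mul_le_mul_of_nonneg_left hdiff hk0.le]

/-- For all sufficiently large real `k` there is a unique `b ∈ (0, log k)`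
with `b - log(1 - b/log k) = log log k`. Moreover, if `a : ℝ → ℝ` satisfies `a(k) ∈ (0,1)` and
`a(k)·(1+a(k))^{k-1} = 1` for all `k > 1`, and `b : ℝ → ℝ` satisfies `b(k) ∈ (0, log k)` and
`b(k) - log(1 - b(k)/log k) = log log k` for all sufficiently large `k`, then
`a(k) - (log k - b(k))/k = O((log k)²/k²)` as `k → ∞`. -/
theorem stmt18 :
    (∀ᶠ k : ℝ in atTop,
        ∃! b : ℝ, b ∈ Set.Ioo (0 : ℝ) (Real.log k)
          ∧ b - Real.log (1 - b / Real.log k) = Real.log (Real.log k))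
      ∧ (∀ a b : ℝ → ℝ,
          (∀ k : ℝ, 1 < k → a k ∈ Set.Ioo (0 : ℝ) 1 ∧ a k * (1 + a k) ^ (k - 1) = 1) →
          (∀ᶠ k : ℝ in atTop, b k ∈ Set.Ioo (0 : ℝ) (Real.log k)
            ∧ b k - Real.log (1 - b k / Real.log k) = Real.log (Real.log k)) →
          Asymptotics.IsBigO atTop
            (fun k : ℝ => a k - (Real.log k - b k) / k)
            (fun k : ℝ => (Real.log k) ^ 2 / k ^ 2)) := by
  refine ⟨?_, fun a b ha hb => ?_⟩
  · filter_upwards [tendsto_log_atTop.eventually_gt_atTop 1] with k hk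
    exact existsUnique_sub_log_one_sub_div_eq hk
  · refine Asymptotics.IsBigO.of_bound 12 ?_
    filter_upwards [hb, eventually_ge_atTop 2, tendsto_log_atTop.eventually_ge_atTop 1]
      with k hbk hk hlog
    obtain ⟨hx, hax⟩ := ha k (by linarith)
    have hpos : 0 < 1 + a k := by linarith [hx.1]
    have h : log (a k) + (k - 1) * log (1 + a k) = 0 := by
      rw [← log_rpow hpos, ← log_mul hx.1.ne' (rpow_pos_of_pos hpos _).ne', hax, log_one]
    have hu := (sub_log_one_sub_div_eq_iff (by linarith) hbk.1.2).1 hbk.2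
    rw [norm_eq_abs, norm_of_nonneg (by positivity)]
    exact abs_sub_div_le hk hlog hx h (sub_pos.2 hbk.1.2) hu
end

section
/- Let k > r ≥ 1 be integers and let α ∈ (0,1) satisfy α^r·(1+α)^{k-r} = 1. Define f(x) := α·H(x^k) - x^{k-r}·H(x^r) for real x, and let x₀ := (1+α)^{-1/r} (real power). Then f(x₀) = 0 and the derivative of f at x₀ equals 0; i.e., x₀ is a root of f of multiplicity at least two. -/
lemma hasDerivAt_mul_binEntropy_pow_sub (m r : ℕ) (α x : ℝ) (hx : 0 < x)
    (hk : x ^ (m + r) ≠ 1) (hr : x ^ r ≠ 1) :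
    HasDerivAt (fun x : ℝ => α * Real.binEntropy (x ^ (m + r)) - x ^ m * Real.binEntropy (x ^ r))
      ((α * ((m + r : ℕ) * x ^ (m + r) * (Real.log (1 - x ^ (m + r)) - Real.log (x ^ (m + r))))
        - (m * x ^ m * Real.binEntropy (x ^ r)
          + x ^ m * (r * x ^ r * (Real.log (1 - x ^ r) - Real.log (x ^ r))))) / x) x := by
  have pow_deriv (n : ℕ) : HasDerivAt (fun y : ℝ => y ^ n) (n * x ^ n / x) x := by
    refine (hasDerivAt_pow n x).congr_deriv ?_
    rcases n with _ | n
    · simp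
    · rw [pow_succ, Nat.add_sub_cancel]
      field_simp
  have comp_deriv (n : ℕ) (hn : x ^ n ≠ 1) :
      HasDerivAt (fun y : ℝ => Real.binEntropy (y ^ n))
        ((Real.log (1 - x ^ n) - Real.log (x ^ n)) * (n * x ^ n / x)) x :=
    (Real.hasDerivAt_binEntropy (pow_pos hx n).ne' hn).comp x (pow_deriv n)
  refine (((comp_deriv (m + r) hk).const_mul α).sub
    ((pow_deriv m).mul (comp_deriv r hr))).congr_deriv ?_
  ring

lemma rpow_neg_inv_pow_eq (m r : ℕ) (hr : r ≠ 0) (α : ℝ) (hα : 0 < α)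
    (h : α ^ r * (1 + α) ^ m = 1) :
    ((1 + α) ^ (-(1 / (r : ℝ)))) ^ r = 1 / (1 + α) ∧ ((1 + α) ^ (-(1 / (r : ℝ)))) ^ m = α := by
  have hβ : 0 < 1 + α := by linarith
  have hxr : ((1 + α) ^ (-(1 / (r : ℝ)))) ^ r = 1 / (1 + α) := by
    rw [Real.rpow_neg hβ.le, inv_pow, one_div, Real.rpow_inv_natCast_pow hβ.le hr, one_div]
  refine ⟨hxr, ?_⟩
  refine (pow_left_inj₀ (by positivity) hα.le hr).1 ?_
  rw [← pow_mul, mul_comm m r, pow_mul, hxr, div_pow, one_pow]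
  exact ((eq_div_iff (by positivity)).2 h).symm

/-- Let `k > r ≥ 1` be integers and `α ∈ (0,1)` satisfy
`α^r·(1+α)^{k-r} = 1`. Let `f(x) := α·H(x^k) - x^{k-r}·H(x^r)` and
`x₀ := (1+α)^{-1/r}` (real power). Then `f(x₀) = 0` and `f'(x₀) = 0`, i.e. `x₀` is a root of
`f` of multiplicity at least two. -/
theorem stmt19 (k r : ℕ) (hr : 1 ≤ r) (hrk : r < k) (α : ℝ) (hα0 : 0 < α) (hα1 : α < 1)
    (hfe : α ^ r * (1 + α) ^ (k - r) = 1) :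
    (fun x : ℝ => α * Real.binEntropy (x ^ k) - x ^ (k - r) * Real.binEntropy (x ^ r))
        ((1 + α) ^ (-(1 / (r : ℝ)))) = 0
      ∧ deriv (fun x : ℝ => α * Real.binEntropy (x ^ k) - x ^ (k - r) * Real.binEntropy (x ^ r))
          ((1 + α) ^ (-(1 / (r : ℝ)))) = 0 := by
  obtain ⟨m, rfl⟩ : ∃ m, k = m + r := ⟨k - r, by omega⟩
  rw [Nat.add_sub_cancel] at hfe ⊢
  have hβ : 0 < 1 + α := by linarith
  obtain ⟨hxr, hxm⟩ := rpow_neg_inv_pow_eq m r (by omega) α hα0 hfe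
  have hx : 0 < (1 + α) ^ (-(1 / (r : ℝ))) := Real.rpow_pos_of_pos hβ _
  generalize (1 + α) ^ (-(1 / (r : ℝ))) = x at *
  have hxk : x ^ (m + r) = α / (1 + α) := by rw [pow_add, hxr, hxm, mul_one_div]
  have hu : 1 - α / (1 + α) = 1 / (1 + α) := by field_simp; ring
  have hv : 1 - 1 / (1 + α) = α / (1 + α) := by field_simp; ring
  constructor
  · simp only [hxk, hxr, hxm]
    rw [← hv, Real.binEntropy_one_sub, sub_self]
  · have hlog : r * Real.log α + m * Real.log (1 + α) = 0 := by
      have h := congrArg Real.log hfe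
      rwa [Real.log_mul (by positivity) (by positivity), Real.log_pow, Real.log_pow,
        Real.log_one] at h
    rw [(hasDerivAt_mul_binEntropy_pow_sub m r α x hx
      (by rw [hxk]; exact ((div_lt_one hβ).2 (by linarith)).ne)
      (by rw [hxr]; exact ((div_lt_one hβ).2 (by linarith)).ne)).deriv]
    rw [hxk, hxr, hxm, Real.binEntropy_eq_negMulLog_add_negMulLog_one_sub, hu, hv]
    simp only [Real.negMulLog]
    rw [Real.log_div hα0.ne' hβ.ne', Real.log_div one_ne_zero hβ.ne', Real.log_one]
    refine div_eq_zero_iff.2 (Or.inl ?_)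
    push_cast
    field_simp
    linear_combination (-(α * (1 + α))) * hlog
end
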